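/- Let R be a TRS over a first-order language L, and let (l, r) be a rewrite rule such that l and r are convertible with respect to →_R (i.e., l ↔*_R r) and l is not a normal form of →_R. Then →_R has UNC if and only if →_{R ∪ {(l, r)}} has UNC. -/

import Mathlib

open FirstOrder Language

/-- `(l, r)` is a rewrite rule: `l` is not a variable and every variable
occurring in `r` also occurs in `l`. -/
def IsRule (L : Language) (p : L.Term ℕ × L.Term ℕ) : Prop :=
  (∀ v : ℕ, p.1 ≠ Term.var v) ∧ p.2.varFinset ⊆ p.1.varFinset

/-- The one-step rewrite relation of a finite set `R` of rules:
root steps are instances of rules, and rewriting is closed under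
rewriting one argument of a function application. -/
inductive Rew (L : Language) (R : Finset (L.Term ℕ × L.Term ℕ)) :
    L.Term ℕ → L.Term ℕ → Prop
  | root (l r : L.Term ℕ) (σ : ℕ → L.Term ℕ) :
      (l, r) ∈ R → Rew L R (l.subst σ) (r.subst σ)
  | congr {n : ℕ} (f : L.Functions n) (ts : Fin n → L.Term ℕ) (i : Fin n)
      (t' : L.Term ℕ) :
      Rew L R (ts i) t' →
      Rew L R (Term.func f ts) (Term.func f (Function.update ts i t'))

/-- `t` is a normal form of `→_R`. -/
def NF {L : Language} (R : Finset (L.Term ℕ × L.Term ℕ)) (t : L.Term ℕ) : Prop :=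
  ∀ u, ¬ Rew L R t u

/-- `→_R` has unique normal forms with respect to conversion. -/
def UNC {L : Language} (R : Finset (L.Term ℕ × L.Term ℕ)) : Prop :=
  ∀ s t : L.Term ℕ, Relation.EqvGen (Rew L R) s t → NF R s → NF R t → s = t

section

open Relation

variable {L : Language}

theorem subst_subst_term (t : L.Term ℕ) (σ τ : ℕ → L.Term ℕ) :
    (t.subst σ).subst τ = t.subst fun v => (σ v).subst τ := by
  induction t with
  | var v => rfl
  | func f ts ih =>
    simp only [Term.subst]
    exact congrArg _ (funext ih)

theorem Rew.subst {R : Finset (L.Term ℕ × L.Term ℕ)} {s t : L.Term ℕ}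
    (h : Rew L R s t) (σ : ℕ → L.Term ℕ) : Rew L R (s.subst σ) (t.subst σ) := by
  induction h with
  | root l r τ hlr =>
    rw [subst_subst_term, subst_subst_term]
    exact .root l r _ hlr
  | congr f ts i t' _ ih =>
    have hup : (fun j => (Function.update ts i t' j).subst σ) =
        Function.update (fun j => (ts j).subst σ) i (t'.subst σ) := by
      funext j
      exact Function.apply_update (fun _ u => Term.subst u σ) ts i t' j
    simp only [Term.subst, hup]
    exact .congr f _ i _ ih

theorem Rew.mono {R S : Finset (L.Term ℕ × L.Term ℕ)} (hRS : R ⊆ S) {s t : L.Term ℕ}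
    (h : Rew L R s t) : Rew L S s t := by
  induction h with
  | root l r σ hlr => exact .root l r σ (hRS hlr)
  | congr f ts i t' _ ih => exact .congr f ts i t' ih

theorem eqvGen_rew_subst {R : Finset (L.Term ℕ × L.Term ℕ)} {s t : L.Term ℕ}
    (h : EqvGen (Rew L R) s t) (σ : ℕ → L.Term ℕ) :
    EqvGen (Rew L R) (s.subst σ) (t.subst σ) := by
  induction h with
  | rel _ _ h => exact .rel _ _ (h.subst σ)
  | refl _ => exact .refl _
  | symm _ _ _ ih => exact ih.symm
  | trans _ _ _ _ _ ih₁ ih₂ => exact ih₁.trans _ _ _ ih₂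

theorem eqvGen_rew_update {R : Finset (L.Term ℕ × L.Term ℕ)} {n : ℕ} (f : L.Functions n)
    (ts : Fin n → L.Term ℕ) (i : Fin n) {s t : L.Term ℕ} (h : EqvGen (Rew L R) s t) :
    EqvGen (Rew L R) (Term.func f (Function.update ts i s))
      (Term.func f (Function.update ts i t)) := by
  induction h with
  | rel s t h =>
    have h' := Rew.congr f (Function.update ts i s) i t (by simpa using h)
    rw [Function.update_idem] at h'
    exact .rel _ _ h'
  | refl _ => exact .refl _
  | symm _ _ _ ih => exact ih.symm
  | trans _ _ _ _ _ ih₁ ih₂ => exact ih₁.trans _ _ _ ih₂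

/-- Rules whose sides are `R`-convertible generate only `R`-convertible steps. -/
theorem Rew.eqvGen_of_rules {R S : Finset (L.Term ℕ × L.Term ℕ)}
    (hS : ∀ p ∈ S, EqvGen (Rew L R) p.1 p.2) {s t : L.Term ℕ} (h : Rew L S s t) :
    EqvGen (Rew L R) s t := by
  induction h with
  | root l r σ hlr => exact eqvGen_rew_subst (hS _ hlr) σ
  | congr f ts i t' _ ih => simpa using eqvGen_rew_update f ts i ih

/-- Rules whose left-hand sides are `R`-reducible reduce only `R`-reducible terms. -/
theorem Rew.exists_of_rules {R S : Finset (L.Term ℕ × L.Term ℕ)}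
    (hS : ∀ p ∈ S, ∃ u, Rew L R p.1 u) {s t : L.Term ℕ} (h : Rew L S s t) :
    ∃ u, Rew L R s u := by
  induction h with
  | root l r σ hlr =>
    obtain ⟨u, hu⟩ := hS _ hlr
    exact ⟨_, hu.subst σ⟩
  | congr f ts i t' _ ih =>
    obtain ⟨u, hu⟩ := ih
    exact ⟨_, .congr f ts i u hu⟩

theorem Rew.of_mem {R : Finset (L.Term ℕ × L.Term ℕ)} {p : L.Term ℕ × L.Term ℕ}
    (hp : p ∈ R) : Rew L R p.1 p.2 := by
  have hvar (t : L.Term ℕ) : t.subst Term.var = t := by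
    induction t with
    | var v => rfl
    | func f ts ih => exact congrArg _ (funext ih)
  simpa only [hvar] using Rew.root p.1 p.2 Term.var hp

end

theorem unc_iff_unc_add_rule {L : Language} [DecidableEq (L.Term ℕ)]
    (R : Finset (L.Term ℕ × L.Term ℕ)) (hR : ∀ p ∈ R, IsRule L p)
    (l r : L.Term ℕ) (hrule : IsRule L (l, r))
    (hconv : Relation.EqvGen (Rew L R) l r) (hl : ¬ NF R l) :
    UNC R ↔ UNC (insert (l, r) R) := by
  have hmono {s t : L.Term ℕ} (h : Rew L R s t) : Rew L (insert (l, r) R) s t :=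
    h.mono (Finset.subset_insert _ _)
  have hconv_iff (s t : L.Term ℕ) : Relation.EqvGen (Rew L (insert (l, r) R)) s t ↔
      Relation.EqvGen (Rew L R) s t := by
    refine ⟨fun h => ?_, fun h => h.mono fun _ _ => hmono⟩
    have hrules : ∀ p ∈ insert (l, r) R, Relation.EqvGen (Rew L R) p.1 p.2 :=
      Finset.forall_mem_insert _ _ _ |>.2 ⟨hconv, fun p hp => .rel _ _ (.of_mem hp)⟩
    induction h with
    | rel _ _ h => exact h.eqvGen_of_rules hrules
    | refl _ => exact .refl _
    | symm _ _ _ ih => exact ih.symm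
    | trans _ _ _ _ _ ih₁ ih₂ => exact ih₁.trans _ _ _ ih₂
  have hnf_iff (s : L.Term ℕ) : NF (insert (l, r) R) s ↔ NF R s := by
    refine ⟨fun h u hu => h u (hmono hu), fun h u hu => ?_⟩
    have hrules : ∀ p ∈ insert (l, r) R, ∃ u, Rew L R p.1 u :=
      Finset.forall_mem_insert _ _ _ |>.2
        ⟨by simpa [NF] using hl, fun p hp => ⟨_, .of_mem hp⟩⟩
    obtain ⟨v, hv⟩ := hu.exists_of_rules hrules
    exact h v hv
  simp only [UNC, hconv_iff, hnf_iff]
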